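/- Let M be a strongly homogeneous L-structure, and let A⁰ ⊆ B⁰ and A⁰ ⊆ C⁰ be subsets of M with B⁰ ∩ C⁰ = A⁰. Let f : B⁰ → M and g : C⁰ → M be elementary maps with f and g agreeing on A⁰. If B⁰ and C⁰ are weakly orthogonal over A⁰, then the common extension f ∪ g : B⁰ ∪ C⁰ → M (defined by f on B⁰ and by g on C⁰) is an elementary map; moreover, the images f(B⁰) and g(C⁰) are weakly orthogonal over f(A⁰). -/

import Mathlib

open FirstOrder FirstOrder.Language Set

universe u v w

/-- `b ≡_A b'`: the tuples `b` and `b'` satisfy the same first-order `L`-formulas with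
parameters from `A` in `M`. -/
def SameType (L : FirstOrder.Language.{u, v}) {M : Type w} [L.Structure M] (A : Set M)
    {ι : Type*} (b b' : ι → M) : Prop :=
  ∀ (m : ℕ) (φ : L.Formula (ι ⊕ Fin m)) (p : Fin m → M), (∀ k, p k ∈ A) →
    (φ.Realize (Sum.elim b p) ↔ φ.Realize (Sum.elim b' p))

/-- The formula `φ` with parameters `p` isolates the type of the tuple `b` over the
parameter set `P`. -/
def Isolates {L : FirstOrder.Language.{u, v}} {M : Type w} [L.Structure M] {ι : Type*} {m : ℕ}
    (φ : L.Formula (ι ⊕ Fin m)) (p : Fin m → M) (P : Set M) (b : ι → M) : Prop :=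
  φ.Realize (Sum.elim b p) ∧ ∀ c : ι → M, φ.Realize (Sum.elim c p) → SameType L P c b

/-- The type `tp(b/P)` is isolated: some formula with parameters from `P` isolates it. -/
def IsolatedType (L : FirstOrder.Language.{u, v}) {M : Type w} [L.Structure M] (P : Set M)
    {ι : Type*} (b : ι → M) : Prop :=
  ∃ (m : ℕ) (φ : L.Formula (ι ⊕ Fin m)) (p : Fin m → M),
    (∀ k, p k ∈ P) ∧ Isolates φ p P b

/-- `(b_i)` is a construction sequence over `A`: each `tp(b_i / A ∪ {b_j : j < i})` is
isolated. -/
def IsConstructionSequence (L : FirstOrder.Language.{u, v}) {M : Type w} [L.Structure M]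
    (A : Set M) {ι : Type*} [LinearOrder ι] (b : ι → M) : Prop :=
  ∀ i : ι, IsolatedType L (A ∪ b '' {j | j < i}) ![b i]

/-- `B ⫛^wo_A C`: the tuples `B` and `C` are weakly orthogonal over `A`. -/
def WeaklyOrthogonal (L : FirstOrder.Language.{u, v}) {M : Type w} [L.Structure M] (A : Set M)
    {ιB ιC : Type*} (B : ιB → M) (C : ιC → M) : Prop :=
  ∀ (B' : ιB → M) (C' : ιC → M), SameType L A B' B → SameType L A C' C →
    SameType L A (Sum.elim B' C') (Sum.elim B C)

/-- `f` is an elementary map on the subset `S` of `M`. -/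
def IsElementaryMapOn (L : FirstOrder.Language.{u, v}) {M : Type w} [L.Structure M]
    (S : Set M) (f : M → M) : Prop :=
  ∀ (n : ℕ) (φ : L.Formula (Fin n)) (a : Fin n → M), (∀ k, a k ∈ S) →
    (φ.Realize a ↔ φ.Realize (f ∘ a))

/-- `M` is strongly homogeneous: any two tuples with the same type over a set of parameters
are conjugate by an automorphism fixing those parameters pointwise. -/
def StronglyHomogeneous (L : FirstOrder.Language.{u, v}) (M : Type w) [L.Structure M] : Prop :=
  ∀ (P : Set M) (ι : Type w) (x y : ι → M), SameType L P x y →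
    ∃ σ : M ≃[L] M, (∀ a ∈ P, σ a = a) ∧ ∀ i, σ (x i) = y i

section SameType

variable {L : FirstOrder.Language.{u, v}} {M : Type w} [L.Structure M]

theorem SameType.symm {A : Set M} {ι : Type*} {x y : ι → M} (h : SameType L A x y) :
    SameType L A y x :=
  fun m φ p hp => (h m φ p hp).symm

theorem SameType.trans {A : Set M} {ι : Type*} {x y z : ι → M} (h : SameType L A x y)
    (h' : SameType L A y z) : SameType L A x z :=
  fun m φ p hp => (h m φ p hp).trans (h' m φ p hp)

theorem SameType.mono {A A' : Set M} (hA : A' ⊆ A) {ι : Type*} {x y : ι → M}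
    (h : SameType L A x y) : SameType L A' x y :=
  fun m φ p hp => h m φ p fun k => hA (hp k)

/-- An automorphism fixing `A` pointwise preserves types over `A`. -/
theorem sameType_comp_equiv (σ : M ≃[L] M) {A : Set M} (hσ : ∀ a ∈ A, σ a = a) {ι : Type*}
    (x : ι → M) : SameType L A (σ ∘ x) x := by
  intro m φ p hp
  have h : Sum.elim (σ ∘ x) p = σ ∘ Sum.elim x p := by
    rw [Sum.comp_elim]
    congr 1
    exact funext fun k => (hσ _ (hp k)).symm
  rw [h]
  exact StrongHomClass.realize_formula σ φ

/-- Automorphisms transport equality of types. -/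
theorem SameType.image (σ : M ≃[L] M) {A : Set M} {ι : Type*} {x y : ι → M}
    (h : SameType L A x y) : SameType L (σ '' A) (σ ∘ x) (σ ∘ y) := by
  intro m φ p hp
  choose q hq hqp using hp
  obtain rfl : σ ∘ q = p := funext hqp
  rw [← Sum.comp_elim, ← Sum.comp_elim, StrongHomClass.realize_formula,
    StrongHomClass.realize_formula]
  exact h m φ q hq

open scoped Classical in
/-- An elementary map preserves the type over `∅` of every tuple from its domain. -/
theorem IsElementaryMapOn.sameType {S : Set M} {f : M → M} (hf : IsElementaryMapOn L S f)
    {ι : Type*} (x : ι → M) (hx : ∀ i, x i ∈ S) : SameType L ∅ x (f ∘ x) := by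
  intro m φ p hp
  obtain rfl : m = 0 := by
    rcases m with _ | m
    · rfl
    · exact (hp 0).elim
  have hS : ∀ i, Sum.elim x p i ∈ S := by
    rintro (i | i)
    · exact hx i
    · exact i.elim0
  have he : Sum.elim (f ∘ x) p = f ∘ Sum.elim x p := by
    rw [Sum.comp_elim]
    congr 1
    exact Subsingleton.elim _ _
  rw [he]
  let e := φ.freeVarFinset.equivFin
  let ψ : L.Formula (Fin φ.freeVarFinset.card) := BoundedFormula.restrictFreeVar φ e
  have key : ∀ v : ι ⊕ Fin 0 → M, ψ.Realize (fun k => v (e.symm k)) ↔ φ.Realize v := by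
    intro v
    exact BoundedFormula.realize_restrictFreeVar v fun a => by simp
  rw [← key, ← key]
  exact hf _ ψ _ fun k => hS _

/-- In a strongly homogeneous structure, elementary maps extend to automorphisms. -/
theorem StronglyHomogeneous.exists_equiv_extending (hM : StronglyHomogeneous L M) {S : Set M}
    {f : M → M} (hf : IsElementaryMapOn L S f) : ∃ σ : M ≃[L] M, ∀ a ∈ S, σ a = f a := by
  obtain ⟨σ, -, hσ⟩ := hM ∅ S (fun x => x) _ (hf.sameType (fun x : S => (x : M)) fun x => x.2)
  exact ⟨σ, fun a ha => hσ ⟨a, ha⟩⟩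

end SameType

open scoped Classical in
/-- If `f` and `g` are elementary maps on `B⁰` and `C⁰` agreeing on
`A⁰ = B⁰ ∩ C⁰`, and `B⁰ ⫛^wo_{A⁰} C⁰`, then the common extension `f ∪ g` is an elementary map
on `B⁰ ∪ C⁰`, and `f(B⁰) ⫛^wo_{f(A⁰)} g(C⁰)`. -/
theorem elementary_map_amalgamation
    {L : FirstOrder.Language.{u, v}} {M : Type w} [L.Structure M]
    (hM : StronglyHomogeneous L M)
    (A B C : Set M) (hAB : A ⊆ B) (hAC : A ⊆ C) (hBC : B ∩ C = A)
    (f g : M → M)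
    (hf : IsElementaryMapOn L B f) (hg : IsElementaryMapOn L C g)
    (hfg : ∀ a ∈ A, f a = g a)
    (hwo : WeaklyOrthogonal L A (fun x : B => (x : M)) (fun x : C => (x : M))) :
    IsElementaryMapOn L (B ∪ C) (fun x => if x ∈ B then f x else g x) ∧
    WeaklyOrthogonal L (f '' A) (fun x : B => f x) (fun x : C => g x) := by
  obtain ⟨σ, hσ⟩ := hM.exists_equiv_extending hf
  obtain ⟨τ, hτ⟩ := hM.exists_equiv_extending hg
  have hσA : σ '' A = f '' A := image_congr fun a ha => hσ a (hAB ha)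
  have hσA' : σ.symm '' (f '' A) = A := by
    rw [← hσA, image_image]
    simp
  have hσB : (σ ∘ fun x : B => (x : M)) = fun x : B => f x := funext fun x => hσ x x.2
  have hσB' : (σ.symm ∘ fun x : B => f x) = fun x : B => (x : M) := by
    rw [← hσB]
    exact funext fun x => by simp
  have hC : SameType L A (σ.symm ∘ fun x : C => g x) (fun x : C => (x : M)) := by
    have h := sameType_comp_equiv (σ.symm.comp τ) (A := A) (fun a ha => by
      rw [Equiv.comp_apply, hτ a (hAC ha), ← hfg a ha, ← hσ a (hAB ha)]
      exact σ.symm_apply_apply a)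
      (fun x : C => (x : M))
    convert h using 1
    exact funext fun x => congrArg σ.symm (hτ x x.2).symm
  have hcancel : ∀ {ι : Type w} (y : ι → M), σ ∘ σ.symm ∘ y = y :=
    fun y => funext fun i => σ.apply_symm_apply (y i)
  have hBg := hwo _ _ (fun _ _ _ _ => Iff.rfl) hC
  constructor
  · intro n φ a ha
    have hu : SameType L ∅ (Sum.elim (fun x : B => f x) fun x : C => g x)
        (Sum.elim (fun x : B => (x : M)) fun x : C => (x : M)) := by
      have h := (sameType_comp_equiv σ (A := ∅) (fun _ h => h.elim) _).trans
        (hBg.mono (empty_subset A))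
      rwa [Sum.comp_elim, hσB, hcancel] at h
    have hr : ∀ k, a k ∉ B → a k ∈ C := fun k hk => (ha k).resolve_left hk
    let r : Fin n → (B ⊕ C) ⊕ Fin 0 := fun k =>
      if h : a k ∈ B then .inl (.inl ⟨a k, h⟩) else .inl (.inr ⟨a k, hr k h⟩)
    have h := hu 0 (φ.relabel r) Fin.elim0 (fun k => k.elim0)
    rw [Formula.realize_relabel, Formula.realize_relabel] at h
    convert h.symm using 2
    · funext k
      by_cases hk : a k ∈ B <;> simp [r, hk]
    · funext k
      by_cases hk : a k ∈ B <;> simp [r, hk]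
  · intro B' C' hB' hC'
    have hB'' := hB'.image σ.symm
    have hC'' := hC'.image σ.symm
    rw [hσA'] at hB'' hC''
    rw [hσB'] at hB''
    have h := ((hwo _ _ hB'' (hC''.trans hC)).trans hBg.symm).image σ
    rwa [hσA, Sum.comp_elim, Sum.comp_elim, hcancel, hcancel, hcancel, hσB] at h
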